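/- Let ω₁, ω₂, ω₃, ω₄ be ℝ-linearly independent quaternions with lattice Λ = {w_k : k ∈ ℤ⁴}, w_k = 2(k₁ω₁ + ⋯ + k₄ω₄), and let ζ₄ be the associated Weierstrass zeta function on ℍ \ Λ. Then the third iterated Fréchet derivative of ζ₄ is periodic with respect to Λ: for every lattice vector w ∈ Λ and every x ∈ ℍ with x ∉ Λ, iteratedFDeriv ℝ 3 ζ₄ (x + w) = iteratedFDeriv ℝ 3 ζ₄ x (equality of trilinear maps; equivalently, all third directional derivatives of ζ₄ agree at x + w and at x). -/

import Mathlib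

noncomputable section

/-- The lattice vector `w_k = 2(k₁ω₁ + ⋯ + k₄ω₄)` in the quaternions. -/
def wk (ω : Fin 4 → Quaternion ℝ) (k : Fin 4 → ℤ) : Quaternion ℝ :=
  2 * ∑ i : Fin 4, (k i : ℝ) • ω i

/-- The Weierstrass zeta function
`ζ₄(x) = x⁻¹ + Σ_{k ≠ 0} [ (x − w_k)⁻¹ + Σ_{μ=0}^{3} (w_k⁻¹x)^μ w_k⁻¹ ]`. -/
def zeta4 (ω : Fin 4 → Quaternion ℝ) (x : Quaternion ℝ) : Quaternion ℝ :=
  x⁻¹ + ∑' k : {k : Fin 4 → ℤ // k ≠ 0},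
    ((x - wk ω k.1)⁻¹ +
      ∑ μ ∈ Finset.range 4, ((wk ω k.1)⁻¹ * x) ^ μ * (wk ω k.1)⁻¹)

open Filter Topology Set

section SeriesDerivatives

variable {α E F : Type*} [NormedAddCommGroup E] [NormedSpace ℝ E] [NormedAddCommGroup F]
  [NormedSpace ℝ F] [CompleteSpace F]

/-- On a preconnected open set, the iterated derivative of a series of `C^N` functions whose
derivatives up to order `N` have summable bounds is the series of iterated derivatives. -/
theorem iteratedFDeriv_tsum_of_isPreconnected {f : α → E → F} {s : Set E} {N : ℕ} {v : ℕ → α → ℝ}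
    (hs : IsOpen s) (hsc : IsPreconnected s) (hf : ∀ i, ∀ x ∈ s, ContDiffAt ℝ N (f i) x)
    (hv : ∀ k ≤ N, Summable (v k))
    (h'f : ∀ k ≤ N, ∀ i, ∀ x ∈ s, ‖iteratedFDeriv ℝ k (f i) x‖ ≤ v k i) {k : ℕ} (hk : k ≤ N)
    {x : E} (hx : x ∈ s) :
    iteratedFDeriv ℝ k (fun y => ∑' i, f i y) x = ∑' i, iteratedFDeriv ℝ k (f i) x := by
  induction k generalizing x with
  | zero =>
    simp_rw [iteratedFDeriv_zero_eq_comp]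
    exact (continuousMultilinearCurryFin0 ℝ E F).symm.toContinuousLinearEquiv.map_tsum
  | succ k IH =>
    have hk' : k ≤ N := by lia
    have hsum : Summable fun i => iteratedFDeriv ℝ k (f i) x :=
      .of_norm_bounded (hv k hk') fun i => h'f k hk' i x hx
    have hder : HasFDerivAt (fun y => ∑' i, iteratedFDeriv ℝ k (f i) y)
        (∑' i, fderiv ℝ (iteratedFDeriv ℝ k (f i)) x) x := by
      refine hasFDerivAt_tsum_of_isPreconnected (hv _ hk) hs hsc (fun i y hy =>
        ((hf i y hy).differentiableAt_iteratedFDeriv (by exact_mod_cast hk)).hasFDerivAt)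
        (fun i y hy => ?_) hx hsum hx
      rw [fderiv_iteratedFDeriv, Function.comp_apply, LinearIsometryEquiv.norm_map]
      exact h'f _ hk i y hy
    have heq : iteratedFDeriv ℝ k (fun y => ∑' i, f i y) =ᶠ[𝓝 x]
        fun y => ∑' i, iteratedFDeriv ℝ k (f i) y := by
      filter_upwards [hs.mem_nhds hx] with y hy using IH hk' hy
    simp_rw [iteratedFDeriv_succ_eq_comp_left, Function.comp_apply]
    rw [heq.fderiv_eq, hder.fderiv]
    exact (continuousMultilinearCurryLeftEquiv ℝ
      (fun _ : Fin (k + 1) => E) F).symm.toContinuousLinearEquiv.map_tsum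

end SeriesDerivatives

section Telescoping

variable {F : Type*} [NormedAddCommGroup F] [CompleteSpace F]

theorem tsum_int_shift_sub_eq_zero {f : ℤ → F} (hf : Tendsto f cofinite (𝓝 0))
    (hs : Summable fun n => f (n - 1) - f n) : ∑' n, (f (n - 1) - f n) = 0 := by
  have hpos : HasSum (fun n : ℕ => f ((n : ℤ) - 1) - f n) (f (-1)) := by
    have h := (hs.comp_injective (i := fun n : ℕ => (n : ℤ)) Nat.cast_injective)
    refine (h.hasSum_iff_tendsto_nat).2 ?_
    have hsum : ∀ n : ℕ, ∑ i ∈ Finset.range n, (f ((i : ℤ) - 1) - f i)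
        = f (-1) - f ((n : ℤ) - 1) := by
      intro n
      induction n with
      | zero => simp
      | succ n ih => rw [Finset.sum_range_succ, ih]; push_cast; simp
    have hlim : Tendsto (fun n : ℕ => f ((n : ℤ) - 1)) atTop (𝓝 0) := by
      rw [← Nat.cofinite_eq_atTop]
      exact hf.comp (Function.Injective.tendsto_cofinite fun a b h => by simpa using h)
    simpa [Function.comp_def, hsum] using hlim.const_sub (f (-1))
  have hneg : HasSum (fun n : ℕ => f (-((n : ℤ) + 1) - 1) - f (-((n : ℤ) + 1))) (-f (-1)) := by
    have h := (hs.comp_injective (i := fun n : ℕ => -((n : ℤ) + 1))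
      fun a b h => by simpa using h)
    refine (h.hasSum_iff_tendsto_nat).2 ?_
    have hsum : ∀ n : ℕ, ∑ i ∈ Finset.range n, (f (-((i : ℤ) + 1) - 1) - f (-((i : ℤ) + 1)))
        = f (-((n : ℤ) + 1)) - f (-1) := by
      intro n
      induction n with
      | zero => simp
      | succ n ih =>
        rw [Finset.sum_range_succ, ih]
        push_cast
        rw [show -((n : ℤ) + 1) - 1 = -((n : ℤ) + 1 + 1) by ring]
        abel
    have hlim : Tendsto (fun n : ℕ => f (-((n : ℤ) + 1))) atTop (𝓝 0) := by
      rw [← Nat.cofinite_eq_atTop]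
      exact hf.comp (Function.Injective.tendsto_cofinite fun a b h => by simpa using h)
    simpa only [Function.comp_def, hsum, zero_sub] using hlim.sub_const (f (-1))
  simpa using (HasSum.of_nat_of_neg_add_one (f := fun n => f (n - 1) - f n) hpos hneg).tsum_eq

theorem tsum_pi_shift_sub_eq_zero {n : ℕ} {g : (Fin (n + 1) → ℤ) → F}
    (hg : Tendsto g cofinite (𝓝 0)) (i : Fin (n + 1))
    (hs : Summable fun k => g (k - Pi.single i 1) - g k) :
    ∑' k, (g (k - Pi.single i 1) - g k) = 0 := by
  let e : (Fin n → ℤ) × ℤ ≃ (Fin (n + 1) → ℤ) :=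
    (Equiv.prodComm _ _).trans (Fin.insertNthEquiv (fun _ => ℤ) i)
  have he : ∀ b m, e (b, m) - Pi.single i 1 = e (b, m - 1) := by
    intro b m
    ext j
    refine Fin.succAboveCases i ?_ (fun j => ?_) j <;> simp [e]
  refine (e.tsum_eq _).symm.trans ((e.summable_iff.2 hs).tsum_prod.trans ?_)
  refine (tsum_congr fun b => ?_).trans tsum_zero
  have hinj : Function.Injective fun m => e (b, m) := fun a c h => by simpa using e.injective h
  have hb := (e.summable_iff.2 hs).prod_factor b
  simp only [Function.comp_apply, he] at hb ⊢
  exact tsum_int_shift_sub_eq_zero (f := fun m => g (e (b, m)))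
    (hg.comp hinj.tendsto_cofinite) hb

end Telescoping

section WeierstrassTerm

variable {A : Type*} [NormedDivisionRing A]

/-- The general term of the Weierstrass zeta series attached to the lattice vector `w`. -/
def weierstrassTerm (w x : A) : A :=
  (x - w)⁻¹ + ∑ μ ∈ Finset.range 4, (w⁻¹ * x) ^ μ * w⁻¹

theorem weierstrassTerm_eq_kernel {w x : A} (hw : w ≠ 0) (h : x ≠ w) :
    weierstrassTerm w x = (w⁻¹ * x) ^ 4 * (w⁻¹ * x - 1)⁻¹ * w⁻¹ := by
  have hy : w⁻¹ * x - 1 ≠ 0 := by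
    rw [sub_ne_zero]
    intro h'
    exact h (by rw [← mul_one w, ← h', mul_inv_cancel_left₀ hw])
  have hxw : (x - w)⁻¹ = (w⁻¹ * x - 1)⁻¹ * w⁻¹ := by
    rw [← mul_inv_rev, mul_sub, mul_inv_cancel_left₀ hw, mul_one]
  rw [weierstrassTerm, hxw, ← Finset.sum_mul, ← add_mul]
  congr 1
  rw [eq_mul_inv_iff_mul_eq₀ hy, add_mul, inv_mul_cancel₀ hy, geom_sum_mul]
  abel

end WeierstrassTerm

section DivisionRing

variable {A : Type*} [NormedDivisionRing A] [NormedAlgebra ℝ A]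

theorem iteratedFDeriv_add_two_id (n : ℕ) (y : A) :
    ‖iteratedFDeriv ℝ (n + 2) (fun z : A => z) y‖ = 0 := by
  have h : fderiv ℝ (fun z : A => z) = fun _ => ContinuousLinearMap.id ℝ A := by
    ext1 z
    exact fderiv_fun_id
  rw [← norm_iteratedFDeriv_fderiv, h, iteratedFDeriv_succ_const]
  simp

theorem norm_iteratedFDeriv_one_id_le (y : A) :
    ‖iteratedFDeriv ℝ 1 (fun z : A => z) y‖ ≤ 1 := by
  rw [← zero_add 1, ← norm_iteratedFDeriv_fderiv]
  simp

theorem norm_iteratedFDeriv_pow_le (m j : ℕ) (y : A) :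
    ‖iteratedFDeriv ℝ j (fun z : A => z ^ m) y‖ ≤ m.descFactorial j * ‖y‖ ^ (m - j) := by
  induction m generalizing j with
  | zero =>
    rcases j with _ | j
    · simp
    · simp [iteratedFDeriv_succ_const]
  | succ m ih =>
    simp_rw [pow_succ']
    have h := norm_iteratedFDeriv_mul_le (𝕜 := ℝ) (N := (j : ℕ∞)) (n := j)
      (f := fun z : A => z) (g := fun z : A => z ^ m) contDiff_id (contDiff_id.pow m) y le_rfl
    refine h.trans ?_
    rcases j with _ | j
    · simp [pow_succ']
    · rw [Finset.sum_range_succ', Finset.sum_range_succ', Finset.sum_eq_zero fun i _ => by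
        rw [iteratedFDeriv_add_two_id, mul_zero, zero_mul]]
      have h0 := ih (j + 1)
      have h1 := ih j
      have hid := norm_iteratedFDeriv_one_id_le y
      have hpow : (m.descFactorial (j + 1) : ℝ) * (‖y‖ * ‖y‖ ^ (m - (j + 1)))
          = m.descFactorial (j + 1) * ‖y‖ ^ (m - j) := by
        rcases lt_or_ge j m with hjm | hjm
        · rw [← pow_succ', show m - (j + 1) + 1 = m - j by lia]
        · rw [Nat.descFactorial_of_lt (show m < j + 1 by lia), Nat.cast_zero, zero_mul, zero_mul]
      have hdesc : (m + 1).descFactorial (j + 1)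
          = (j + 1) * m.descFactorial j + m.descFactorial (j + 1) := by
        rw [Nat.succ_descFactorial_succ, Nat.descFactorial_succ]
        rcases le_or_gt j m with hjm | hjm
        · obtain ⟨c, rfl⟩ := Nat.exists_eq_add_of_le hjm
          simp; ring
        · simp [Nat.descFactorial_of_lt hjm]
      rw [hdesc, Nat.add_sub_add_right]
      push_cast
      simp only [zero_add, Nat.choose_one_right, Nat.choose_zero_right, Nat.cast_one, one_mul,
        norm_iteratedFDeriv_zero, Nat.sub_zero, add_mul, Nat.cast_add]
      rw [← hpow]
      have e1 : ((j : ℝ) + 1) * ‖iteratedFDeriv ℝ 1 (fun z : A => z) y‖ *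
          ‖iteratedFDeriv ℝ j (fun z : A => z ^ m) y‖ ≤
          ((j : ℝ) + 1) * 1 * (m.descFactorial j * ‖y‖ ^ (m - j)) := by gcongr
      have e2 : ‖y‖ * ‖iteratedFDeriv ℝ (j + 1) (fun z : A => z ^ m) y‖ ≤
          ‖y‖ * (m.descFactorial (j + 1) * ‖y‖ ^ (m - (j + 1))) := by gcongr
      linarith

theorem norm_iteratedFDeriv_mul_left_mul_right_le (φ : A → A) {a x : A} {j : ℕ} (ha : a ≠ 0)
    (hφ : ContDiffAt ℝ j φ (a * x)) :
    ‖iteratedFDeriv ℝ j (fun z => φ (a * z) * a) x‖ ≤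
      ‖a‖ ^ (j + 1) * ‖iteratedFDeriv ℝ j φ (a * x)‖ := by
  let L : A ≃L[ℝ] A := ContinuousLinearEquiv.equivOfInverse (ContinuousLinearMap.mul ℝ A a)
    (ContinuousLinearMap.mul ℝ A a⁻¹) (fun z => by simp [ha]) (fun z => by simp [ha])
  have hL : ∀ z, L z = a * z := fun z => rfl
  have hLn : ‖(L : A →L[ℝ] A)‖ ≤ ‖a‖ :=
    ContinuousLinearMap.opNorm_le_bound _ (norm_nonneg _) fun z => (norm_mul a z).le
  have hcomp : ContDiffAt ℝ j (φ ∘ L) x :=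
    ContDiffAt.comp x hφ L.contDiff.contDiffAt
  have hR : ‖(ContinuousLinearMap.mul ℝ A).flip a‖ ≤ ‖a‖ :=
    ContinuousLinearMap.opNorm_le_bound _ (norm_nonneg _) fun z => by simp [mul_comm]
  calc ‖iteratedFDeriv ℝ j (fun z => φ (a * z) * a) x‖
      = ‖iteratedFDeriv ℝ j ((ContinuousLinearMap.mul ℝ A).flip a ∘ (φ ∘ L)) x‖ := rfl
    _ ≤ ‖(ContinuousLinearMap.mul ℝ A).flip a‖ * ‖iteratedFDeriv ℝ j (φ ∘ L) x‖ :=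
        ContinuousLinearMap.norm_iteratedFDeriv_comp_left _ hcomp le_rfl
    _ ≤ ‖a‖ * (‖iteratedFDeriv ℝ j φ (a * x)‖ * ‖a‖ ^ j) := by
        have h := L.iteratedFDerivWithin_comp_right φ uniqueDiffOn_univ (mem_univ (L x)) j
        simp only [preimage_univ, iteratedFDerivWithin_univ] at h
        rw [h]
        gcongr
        refine (ContinuousMultilinearMap.norm_compContinuousLinearMap_le _ _).trans ?_
        rw [hL, Finset.prod_const, Finset.card_univ, Fintype.card_fin]
        gcongr
    _ = _ := by ring

theorem contDiffAt_inv_of_ne_zero {n : WithTop ℕ∞} {x : A} (hx : x ≠ 0) :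
    ContDiffAt ℝ n (fun z : A => z⁻¹) x := by
  simpa only [Ring.inverse_eq_inv'] using! contDiffAt_ringInverse ℝ (n := n) (Units.mk0 x hx)

theorem norm_iteratedFDeriv_inv_le {j : ℕ} {x : A} (hx : x ≠ 0) :
    ‖iteratedFDeriv ℝ j (fun z : A => z⁻¹) x‖ ≤
      ‖x‖⁻¹ ^ (j + 1) * ‖iteratedFDeriv ℝ j (fun z : A => z⁻¹) 1‖ := by
  have h := norm_iteratedFDeriv_mul_left_mul_right_le (fun z : A => z⁻¹) (a := x⁻¹) (x := x)
    (j := j) (inv_ne_zero hx) (contDiffAt_inv_of_ne_zero (by simp [hx]))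
  have e : (fun z : A => (x⁻¹ * z)⁻¹ * x⁻¹) = fun z => z⁻¹ := by
    ext z
    simp [hx]
  rwa [e, inv_mul_cancel₀ hx, norm_inv] at h

theorem contDiff_weierstrassTerm_poly {n : WithTop ℕ∞} (w : A) :
    ContDiff ℝ n fun x : A => ∑ μ ∈ Finset.range 4, (w⁻¹ * x) ^ μ * w⁻¹ :=
  ContDiff.sum fun μ _ => ((contDiff_const.mul contDiff_id).pow μ).mul contDiff_const

theorem contDiffAt_sub_inv {n : WithTop ℕ∞} {w x : A} (h : x ≠ w) :
    ContDiffAt ℝ n (fun z => (z - w)⁻¹) x :=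
  (contDiffAt_inv_of_ne_zero (sub_ne_zero.2 h)).comp x (contDiffAt_id.sub contDiffAt_const)

theorem contDiffAt_weierstrassTerm {n : WithTop ℕ∞} {w x : A} (h : x ≠ w) :
    ContDiffAt ℝ n (weierstrassTerm w) x :=
  (contDiffAt_sub_inv h).add (contDiff_weierstrassTerm_poly w).contDiffAt

/-- The third derivative of a cubic polynomial is constant. -/
theorem iteratedFDeriv_three_weierstrassTerm_poly (w x y : A) :
    iteratedFDeriv ℝ 3 (fun x : A => ∑ μ ∈ Finset.range 4, (w⁻¹ * x) ^ μ * w⁻¹) x =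
      iteratedFDeriv ℝ 3 (fun x : A => ∑ μ ∈ Finset.range 4, (w⁻¹ * x) ^ μ * w⁻¹) y := by
  rcases eq_or_ne w 0 with rfl | hw
  · simp
  have hterm : ∀ μ : ℕ, ContDiff ℝ (3 + 1 : ℕ) fun x : A => (w⁻¹ * x) ^ μ * w⁻¹ := fun μ =>
    ((contDiff_const.mul contDiff_id).pow μ).mul contDiff_const
  refine is_const_of_fderiv_eq_zero (𝕜 := ℝ)
    ((contDiff_weierstrassTerm_poly (n := 4) w).differentiable_iteratedFDeriv
      (by norm_num)) (fun z => ?_) x y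
  rw [fderiv_iteratedFDeriv, Function.comp_apply, LinearIsometryEquiv.map_eq_zero_iff,
    iteratedFDeriv_fun_sum_apply fun μ _ => (hterm μ).contDiffAt]
  refine Finset.sum_eq_zero fun μ hμ => norm_le_zero_iff.1 ?_
  refine (norm_iteratedFDeriv_mul_left_mul_right_le (fun z : A => z ^ μ) (inv_ne_zero hw)
    (contDiff_id.pow μ).contDiffAt).trans ?_
  have h := norm_iteratedFDeriv_pow_le μ 4 (w⁻¹ * z)
  rw [Nat.descFactorial_of_lt (Finset.mem_range.1 hμ), Nat.cast_zero, zero_mul] at h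
  exact mul_nonpos_of_nonneg_of_nonpos (by positivity) h

theorem iteratedFDeriv_three_weierstrassTerm_sub {w x y : A} (hx : x ≠ w) (hy : y ≠ w) :
    iteratedFDeriv ℝ 3 (weierstrassTerm w) x - iteratedFDeriv ℝ 3 (weierstrassTerm w) y =
      iteratedFDeriv ℝ 3 (fun z : A => z⁻¹) (x - w) -
        iteratedFDeriv ℝ 3 (fun z : A => z⁻¹) (y - w) := by
  have h : ∀ z, z ≠ w → iteratedFDeriv ℝ 3 (weierstrassTerm w) z =
      iteratedFDeriv ℝ 3 (fun z : A => z⁻¹) (z - w) +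
      iteratedFDeriv ℝ 3 (fun x : A => ∑ μ ∈ Finset.range 4, (w⁻¹ * x) ^ μ * w⁻¹) z := by
    intro z hz
    rw [← iteratedFDeriv_comp_sub]
    exact iteratedFDeriv_add_apply (contDiffAt_sub_inv hz)
      (contDiff_weierstrassTerm_poly w).contDiffAt
  rw [h x hx, h y hy, iteratedFDeriv_three_weierstrassTerm_poly w x y, add_sub_add_right_eq_sub]

variable [ProperSpace A]

theorem exists_norm_iteratedFDeriv_kernel_le :
    ∃ C : ℝ, 0 ≤ C ∧ ∀ j ≤ 3, ∀ y : A, ‖y‖ ≤ 1 / 2 →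
      ‖iteratedFDeriv ℝ j (fun z : A => z ^ 4 * (z - 1)⁻¹) y‖ ≤ C * ‖y‖ ^ (4 - j) := by
  have hne : ∀ y : A, ‖y‖ < 1 → y ≠ 1 := by
    rintro y hy rfl
    simp at hy
  have hbound : ∀ j : ℕ, ∃ M : ℝ, ∀ y ∈ Metric.closedBall (0 : A) (1 / 2),
      ‖iteratedFDeriv ℝ j (fun z : A => (z - 1)⁻¹) y‖ ≤ M := fun j =>
    (isCompact_closedBall _ _).exists_bound_of_continuousOn fun y hy =>
      ((contDiffAt_sub_inv (n := (j : ℕ∞)) (hne y (by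
        rw [mem_closedBall_zero_iff] at hy; linarith))).continuousAt_iteratedFDeriv
          le_rfl).continuousWithinAt
  choose M hM using hbound
  have hM0 : ∀ j, 0 ≤ M j := fun j =>
    (norm_nonneg _).trans (hM j 0 (Metric.mem_closedBall_self (by norm_num)))
  refine ⟨∑ j ∈ Finset.range 4, ∑ i ∈ Finset.range (j + 1),
    (j.choose i : ℝ) * (4 : ℕ).descFactorial i * M (j - i), ?_, fun j hj y hy => ?_⟩
  · exact Finset.sum_nonneg fun j _ => Finset.sum_nonneg fun i _ =>
      mul_nonneg (by positivity) (hM0 _)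
  have hy1 : y ∈ Metric.ball (0 : A) 1 := by
    rw [mem_ball_zero_iff]; linarith
  have hleib := norm_iteratedFDerivWithin_mul_le (𝕜 := ℝ) (N := (j : ℕ∞)) (n := j)
    (f := fun z : A => z ^ 4) (g := fun z : A => (z - 1)⁻¹) (s := Metric.ball (0 : A) 1)
    (contDiff_id.pow 4).contDiffOn
    (fun z hz => (contDiffAt_sub_inv (hne z (by simpa using hz))).contDiffWithinAt)
    Metric.isOpen_ball.uniqueDiffOn hy1 le_rfl
  simp only [iteratedFDerivWithin_of_isOpen _ Metric.isOpen_ball hy1] at hleib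
  refine hleib.trans ?_
  calc _ ≤ ∑ i ∈ Finset.range (j + 1),
        (j.choose i : ℝ) * (4 : ℕ).descFactorial i * M (j - i) * ‖y‖ ^ (4 - j) := by
        refine Finset.sum_le_sum fun i hi => ?_
        have hij : i ≤ j := by simpa [Nat.lt_succ_iff] using hi
        have h1 : ‖iteratedFDeriv ℝ i (fun z : A => z ^ 4) y‖ ≤
            (4 : ℕ).descFactorial i * ‖y‖ ^ (4 - j) := by
          refine (norm_iteratedFDeriv_pow_le 4 i y).trans ?_
          gcongr ?_ * ?_
          exact pow_le_pow_of_le_one (norm_nonneg _) (by linarith) (by lia)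
        have h2 := hM (j - i) y (by rwa [mem_closedBall_zero_iff])
        calc _ ≤ (j.choose i : ℝ) * ((4 : ℕ).descFactorial i * ‖y‖ ^ (4 - j)) * M (j - i) := by
              gcongr
          _ = _ := by ring
    _ ≤ _ := by
        rw [← Finset.sum_mul]
        gcongr
        exact Finset.single_le_sum (f := fun j => ∑ i ∈ Finset.range (j + 1),
          (j.choose i : ℝ) * (4 : ℕ).descFactorial i * M (j - i))
          (fun j _ => Finset.sum_nonneg fun i _ => mul_nonneg (by positivity) (hM0 _))
          (Finset.mem_range.2 (by lia))

theorem exists_norm_iteratedFDeriv_weierstrassTerm_le :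
    ∃ C : ℝ, 0 ≤ C ∧ ∀ j ≤ 3, ∀ w x : A, w ≠ 0 → 2 * ‖x‖ ≤ ‖w‖ →
      ‖iteratedFDeriv ℝ j (weierstrassTerm w) x‖ ≤ C * ‖x‖ ^ (4 - j) * ‖w‖⁻¹ ^ 5 := by
  obtain ⟨C, hC0, hC⟩ := exists_norm_iteratedFDeriv_kernel_le (A := A)
  refine ⟨C, hC0, fun j hj w x hw hx => ?_⟩
  have hwpos : 0 < ‖w‖ := norm_pos_iff.2 hw
  have hxw : x ≠ w := by
    rintro rfl
    linarith
  have hy : ‖w⁻¹ * x‖ ≤ 1 / 2 := by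
    rw [norm_mul, norm_inv, inv_mul_le_iff₀ hwpos]
    linarith
  have heq : weierstrassTerm w =ᶠ[𝓝 x]
      fun z => (fun y : A => y ^ 4 * (y - 1)⁻¹) (w⁻¹ * z) * w⁻¹ := by
    filter_upwards [isOpen_ne.mem_nhds hxw] with z hz using weierstrassTerm_eq_kernel hw hz
  rw [(heq.iteratedFDeriv ℝ j).eq_of_nhds]
  have hsmooth : ContDiffAt ℝ j (fun y : A => y ^ 4 * (y - 1)⁻¹) (w⁻¹ * x) :=
    (contDiff_id.pow 4).contDiffAt.mul (contDiffAt_sub_inv (by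
      intro h
      rw [h, norm_one] at hy
      norm_num at hy))
  refine (norm_iteratedFDeriv_mul_left_mul_right_le _ (inv_ne_zero hw) hsmooth).trans ?_
  calc _ ≤ ‖w⁻¹‖ ^ (j + 1) * (C * ‖w⁻¹ * x‖ ^ (4 - j)) := by
        gcongr
        exact hC j hj _ hy
    _ = C * ‖x‖ ^ (4 - j) * (‖w‖⁻¹ ^ (j + 1) * ‖w‖⁻¹ ^ (4 - j)) := by
        rw [norm_mul, norm_inv]; ring
    _ = _ := by rw [← pow_add, show j + 1 + (4 - j) = 5 by lia]

end DivisionRing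

section Lattice

variable {ω : Fin 4 → Quaternion ℝ}

theorem wk_eq_sum_zsmul (ω : Fin 4 → Quaternion ℝ) (k : Fin 4 → ℤ) :
    wk ω k = ∑ i, k i • (2 * ω i) := by
  rw [wk, Finset.mul_sum]
  exact Finset.sum_congr rfl fun i _ => by rw [mul_smul_comm, Int.cast_smul_eq_zsmul]

theorem wk_add (ω : Fin 4 → Quaternion ℝ) (k m : Fin 4 → ℤ) :
    wk ω (k + m) = wk ω k + wk ω m := by
  simp only [wk_eq_sum_zsmul, Pi.add_apply, add_smul, Finset.sum_add_distrib]

theorem wk_sub (ω : Fin 4 → Quaternion ℝ) (k m : Fin 4 → ℤ) :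
    wk ω (k - m) = wk ω k - wk ω m := by
  simp only [wk_eq_sum_zsmul, Pi.sub_apply, sub_smul, Finset.sum_sub_distrib]

theorem wk_neg (ω : Fin 4 → Quaternion ℝ) (k : Fin 4 → ℤ) : wk ω (-k) = -wk ω k := by
  simp only [wk_eq_sum_zsmul, Pi.neg_apply, neg_smul, Finset.sum_neg_distrib]

theorem wk_zero (ω : Fin 4 → Quaternion ℝ) : wk ω 0 = 0 := by
  simp [wk_eq_sum_zsmul]

theorem add_wk_notMem_range {x : Quaternion ℝ} (hx : x ∉ range (wk ω)) (m : Fin 4 → ℤ) :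
    x + wk ω m ∉ range (wk ω) := by
  rintro ⟨k, hk⟩
  exact hx ⟨k - m, by rw [wk_sub, hk, add_sub_cancel_right]⟩

theorem exists_basis_wk (hω : LinearIndependent ℝ ω) :
    ∃ b : Module.Basis (Fin 4) ℝ (Quaternion ℝ), ∀ i, b i = 2 * ω i := by
  have h2 : LinearIndependent ℝ fun i => 2 * ω i := by
    have h := hω.units_smul fun _ => Units.mk0 (2 : ℝ) two_ne_zero
    convert h using 1
    ext1 i
    simp [two_mul, two_smul, Units.smul_def]
  have hcard : Fintype.card (Fin 4) = Module.finrank ℝ (Quaternion ℝ) := by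
    rw [Quaternion.finrank_eq_four, Fintype.card_fin]
  exact ⟨basisOfLinearIndependentOfCardEqFinrank h2 hcard, fun i =>
    congrFun (coe_basisOfLinearIndependentOfCardEqFinrank h2 hcard) i⟩

theorem summable_norm_wk_inv_pow (hω : LinearIndependent ℝ ω) :
    Summable fun k => ‖wk ω k‖⁻¹ ^ 5 := by
  obtain ⟨b, hb⟩ := exists_basis_wk hω
  let L := Submodule.span ℤ (range b)
  have hrank : Module.finrank ℤ L < 5 := by
    rw [Module.finrank_eq_card_basis (b.restrictScalars ℤ), Fintype.card_fin]
    norm_num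
  have h := ZLattice.summable_norm_pow_inv L 5 hrank
  convert ((b.restrictScalars ℤ).equivFun.symm.toEquiv.summable_iff).2 h using 1
  ext1 k
  have hk : (((b.restrictScalars ℤ).equivFun.symm k : L) : Quaternion ℝ) = wk ω k := by
    rw [Module.Basis.equivFun_symm_apply, wk_eq_sum_zsmul]
    simp [hb]
  simp only [Function.comp_apply, LinearEquiv.coe_toEquiv]
  rw [← hk]
  rfl

theorem wk_injective (hω : LinearIndependent ℝ ω) : Function.Injective (wk ω) := by
  obtain ⟨b, hb⟩ := exists_basis_wk hω
  intro k m h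
  have hli := Fintype.linearIndependent_iff.1
    (b.linearIndependent.restrict_scalars (R := ℤ) (smul_left_injective ℤ one_ne_zero))
    (k - m) (by simp only [hb, ← wk_eq_sum_zsmul, wk_sub, h, sub_self])
  ext i
  simpa [sub_eq_zero] using hli i

theorem tendsto_norm_wk (hω : LinearIndependent ℝ ω) :
    Tendsto (fun k => ‖wk ω k‖) cofinite atTop := by
  rw [tendsto_atTop]
  intro R
  have hR : 0 < |R| + 1 := by positivity
  have hev := (summable_norm_wk_inv_pow hω).tendsto_cofinite_zero.eventually_lt_const
    (show 0 < (|R| + 1)⁻¹ ^ 5 by positivity)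
  filter_upwards [hev, eventually_cofinite_ne 0] with k hk hk0
  have hpos : 0 < ‖wk ω k‖ :=
    norm_pos_iff.2 fun h => hk0 (wk_injective hω (h.trans (wk_zero ω).symm))
  have h := (inv_lt_inv₀ hpos hR).1 (lt_of_pow_lt_pow_left₀ 5 (by positivity) hk)
  linarith [le_abs_self R]

theorem isClosed_range_wk (hω : LinearIndependent ℝ ω) : IsClosed (range (wk ω)) := by
  refine (isProperMap_iff_tendsto_cocompact.2
    ⟨continuous_of_discreteTopology, ?_⟩).isClosedMap.isClosed_range
  rw [cocompact_eq_cofinite, ← Metric.cobounded_eq_cocompact]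
  exact tendsto_norm_atTop_iff_cobounded.1 (tendsto_norm_wk hω)

end Lattice

section Zeta

variable {ω : Fin 4 → Quaternion ℝ}

theorem exists_summable_bound_weierstrassTerm (hω : LinearIndependent ℝ ω)
    {K : Set (Quaternion ℝ)} (hK : IsCompact K) (hKω : Disjoint K (range (wk ω))) {j : ℕ}
    (hj : j ≤ 3) :
    ∃ v : (Fin 4 → ℤ) → ℝ, Summable v ∧
      ∀ k, ∀ x ∈ K, ‖iteratedFDeriv ℝ j (weierstrassTerm (wk ω k)) x‖ ≤ v k := by
  classical
  have hloc : ∀ k, ∃ M, ∀ x ∈ K, ‖iteratedFDeriv ℝ j (weierstrassTerm (wk ω k)) x‖ ≤ M := fun k =>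
    hK.exists_bound_of_continuousOn fun x hx =>
      ((contDiffAt_weierstrassTerm (n := (j : ℕ∞)) fun h =>
        disjoint_left.1 hKω hx ⟨k, h.symm⟩).continuousAt_iteratedFDeriv le_rfl).continuousWithinAt
  choose M hM using hloc
  obtain ⟨R, hR⟩ := hK.isBounded.exists_norm_le
  obtain ⟨C, hC0, hC⟩ := exists_norm_iteratedFDeriv_weierstrassTerm_le (A := Quaternion ℝ)
  let u : (Fin 4 → ℤ) → ℝ := fun k => C * |R| ^ (4 - j) * ‖wk ω k‖⁻¹ ^ 5
  have hu : Summable u := (summable_norm_wk_inv_pow hω).mul_left _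
  refine ⟨fun k => if k ≠ 0 ∧ 2 * |R| ≤ ‖wk ω k‖ then u k else M k, ?_, fun k x hx => ?_⟩
  · refine (summable_congr_cofinite ?_).1 hu
    filter_upwards [eventually_cofinite_ne 0,
      (tendsto_norm_wk hω).eventually_ge_atTop (2 * |R|)] with k hk hkR
    rw [if_pos ⟨hk, hkR⟩]
  · beta_reduce
    split_ifs with h
    · have hxR : ‖x‖ ≤ |R| := (hR x hx).trans (le_abs_self R)
      refine (hC j hj (wk ω k) x
        (fun h0 => h.1 (wk_injective hω (h0.trans (wk_zero ω).symm))) (by linarith [h.2])).trans ?_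
      simp only [u]
      gcongr
    · exact hM k x hx

theorem summable_iteratedFDeriv_weierstrassTerm (hω : LinearIndependent ℝ ω) {j : ℕ} (hj : j ≤ 3)
    {x : Quaternion ℝ} (hx : x ∉ range (wk ω)) :
    Summable fun k => iteratedFDeriv ℝ j (weierstrassTerm (wk ω k)) x := by
  obtain ⟨v, hv, hbound⟩ := exists_summable_bound_weierstrassTerm hω isCompact_singleton
    (disjoint_singleton_left.2 hx) hj
  exact .of_norm_bounded hv fun k => hbound k x rfl

theorem zeta4_eq_tsum_weierstrassTerm (hω : LinearIndependent ℝ ω) {x : Quaternion ℝ}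
    (hx : x ∉ range (wk ω)) : zeta4 ω x = ∑' k, weierstrassTerm (wk ω k) x := by
  have hs : Summable fun k => weierstrassTerm (wk ω k) x := by
    obtain ⟨v, hv, hbound⟩ := exists_summable_bound_weierstrassTerm hω isCompact_singleton
      (disjoint_singleton_left.2 hx) (Nat.zero_le 3)
    refine .of_norm_bounded hv fun k => ?_
    rw [← norm_iteratedFDeriv_zero (𝕜 := ℝ)]
    exact hbound k x rfl
  have h := hs.tsum_subtype_add_tsum_subtype_compl {0}
  rw [← h, tsum_singleton (0 : Fin 4 → ℤ) fun k => weierstrassTerm (wk ω k) x]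
  have h0 : weierstrassTerm (wk ω 0) x = x⁻¹ := by simp [weierstrassTerm, wk_zero]
  rw [h0]
  rfl

theorem iteratedFDeriv_three_zeta4_eq_tsum (hω : LinearIndependent ℝ ω) {x : Quaternion ℝ}
    (hx : x ∉ range (wk ω)) :
    iteratedFDeriv ℝ 3 (zeta4 ω) x = ∑' k, iteratedFDeriv ℝ 3 (weierstrassTerm (wk ω k)) x := by
  have hopen : IsOpen (range (wk ω))ᶜ := (isClosed_range_wk hω).isOpen_compl
  have heq : zeta4 ω =ᶠ[𝓝 x] fun y => ∑' k, weierstrassTerm (wk ω k) y := by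
    filter_upwards [hopen.mem_nhds hx] with y hy using zeta4_eq_tsum_weierstrassTerm hω hy
  obtain ⟨r, hr, hball⟩ := Metric.nhds_basis_closedBall.mem_iff.1 (hopen.mem_nhds hx)
  have hbound : ∀ j, ∃ v : (Fin 4 → ℤ) → ℝ, j ≤ 3 → Summable v ∧
      ∀ k, ∀ y ∈ Metric.closedBall x r,
        ‖iteratedFDeriv ℝ j (weierstrassTerm (wk ω k)) y‖ ≤ v k := by
    intro j
    by_cases hj : j ≤ 3
    · obtain ⟨v, hv⟩ := exists_summable_bound_weierstrassTerm hω (isCompact_closedBall x r)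
        (subset_compl_iff_disjoint_right.1 hball) hj
      exact ⟨v, fun _ => hv⟩
    · exact ⟨0, fun h => absurd h hj⟩
  choose v hv using hbound
  rw [(heq.iteratedFDeriv ℝ 3).eq_of_nhds]
  refine iteratedFDeriv_tsum_of_isPreconnected (N := 3) Metric.isOpen_ball
    (convex_ball x r).isPreconnected (fun k y hy => contDiffAt_weierstrassTerm ?_)
    (fun j hj => (hv j hj).1)
    (fun j hj k y hy => (hv j hj).2 k y (Metric.ball_subset_closedBall hy)) le_rfl
    (Metric.mem_ball_self hr)
  rintro rfl
  exact hball (Metric.ball_subset_closedBall hy) ⟨k, rfl⟩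

theorem tendsto_iteratedFDeriv_inv_sub_wk (hω : LinearIndependent ℝ ω) (x : Quaternion ℝ) :
    Tendsto (fun k => iteratedFDeriv ℝ 3 (fun z : Quaternion ℝ => z⁻¹) (x - wk ω k))
      cofinite (𝓝 0) := by
  have hnorm : Tendsto (fun k => ‖x - wk ω k‖) cofinite atTop := by
    refine tendsto_atTop_mono (fun k => ?_)
      (tendsto_atTop_add_const_right _ (-‖x‖) (tendsto_norm_wk hω))
    rw [← sub_eq_add_neg, norm_sub_rev x]
    exact norm_sub_norm_le _ _
  refine squeeze_zero_norm' (a := fun k => ‖x - wk ω k‖⁻¹ ^ (3 + 1) *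
    ‖iteratedFDeriv ℝ 3 (fun z : Quaternion ℝ => z⁻¹) 1‖) ?_ ?_
  · filter_upwards [hnorm.eventually_gt_atTop 0] with k hk
    exact norm_iteratedFDeriv_inv_le (norm_pos_iff.1 hk)
  · simpa using ((tendsto_inv_atTop_zero.comp hnorm).pow (3 + 1)).mul_const
      ‖iteratedFDeriv ℝ 3 (fun z : Quaternion ℝ => z⁻¹) 1‖

theorem iteratedFDeriv_three_zeta4_add_single (hω : LinearIndependent ℝ ω) (i : Fin 4)
    {x : Quaternion ℝ} (hx : x ∉ range (wk ω)) :
    iteratedFDeriv ℝ 3 (zeta4 ω) (x + wk ω (Pi.single i 1)) =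
      iteratedFDeriv ℝ 3 (zeta4 ω) x := by
  have hx' := add_wk_notMem_range hx (Pi.single i 1)
  have hs := summable_iteratedFDeriv_weierstrassTerm hω le_rfl hx
  have hs' := summable_iteratedFDeriv_weierstrassTerm hω le_rfl hx'
  have hterm : ∀ k, iteratedFDeriv ℝ 3 (weierstrassTerm (wk ω k)) (x + wk ω (Pi.single i 1)) -
      iteratedFDeriv ℝ 3 (weierstrassTerm (wk ω k)) x =
      iteratedFDeriv ℝ 3 (fun z : Quaternion ℝ => z⁻¹) (x - wk ω (k - Pi.single i 1)) -
        iteratedFDeriv ℝ 3 (fun z : Quaternion ℝ => z⁻¹) (x - wk ω k) := by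
    intro k
    rw [iteratedFDeriv_three_weierstrassTerm_sub (fun h => hx' ⟨k, h.symm⟩)
      (fun h => hx ⟨k, h.symm⟩), wk_sub, sub_sub_eq_add_sub]
  have hdiff := hs'.sub hs
  rw [← sub_eq_zero, iteratedFDeriv_three_zeta4_eq_tsum hω hx,
    iteratedFDeriv_three_zeta4_eq_tsum hω hx', ← hs'.tsum_sub hs]
  simp only [hterm] at hdiff ⊢
  exact tsum_pi_shift_sub_eq_zero (g := fun k =>
    iteratedFDeriv ℝ 3 (fun z : Quaternion ℝ => z⁻¹) (x - wk ω k))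
    (tendsto_iteratedFDeriv_inv_sub_wk hω x) i hdiff

end Zeta

/-- The third iterated Fréchet derivative of `ζ₄` (whose directional specializations
are the Weierstrass-type functions `𝒫_α`) is periodic with respect to the lattice. -/
theorem iteratedFDeriv_three_zeta4_periodic (ω : Fin 4 → Quaternion ℝ)
    (hω : LinearIndependent ℝ ω) :
    ∀ w ∈ Set.range (wk ω), ∀ x ∉ Set.range (wk ω),
      iteratedFDeriv ℝ 3 (zeta4 ω) (x + w) = iteratedFDeriv ℝ 3 (zeta4 ω) x := by
  rintro _ ⟨k, rfl⟩
  let P : AddSubgroup (Fin 4 → ℤ) :=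
    { carrier := {m | ∀ x ∉ range (wk ω),
        iteratedFDeriv ℝ 3 (zeta4 ω) (x + wk ω m) = iteratedFDeriv ℝ 3 (zeta4 ω) x}
      zero_mem' := fun x _ => by rw [wk_zero, add_zero]
      add_mem' := fun {m n} hm hn x hx => by
        rw [wk_add, ← add_assoc, hn _ (add_wk_notMem_range hx m), hm x hx]
      neg_mem' := fun {m} hm x hx => by
        rw [← hm _ (add_wk_notMem_range hx (-m)), wk_neg, neg_add_cancel_right] }
  have hk : k = ∑ i, k i • Pi.single i (1 : ℤ) := by
    simpa using (pi_eq_sum_univ' k)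
  have hmem : k ∈ P := by
    rw [hk]
    exact P.sum_mem fun i _ => P.zsmul_mem
      (fun x hx => iteratedFDeriv_three_zeta4_add_single hω i hx) _
  exact hmem

end
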